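/- Let n and m be positive integers and let G be a Whitney-maximum graph in C_{n,m}. Then for each k ∈ {1,…,n}, G has the maximum number of spanning forests composed of exactly k trees among all graphs in C_{n,m}: t_k(G) ≥ t_k(H) for every H ∈ C_{n,m}. -/

import Mathlib

open MvPolynomial

/-- Number of connected components of the spanning subgraph of a graph on `Fin n`
whose edge set is `s`. -/
noncomputable def ncomp (n : ℕ) (s : Set (Sym2 (Fin n))) : ℕ :=
  Nat.card (SimpleGraph.fromEdgeSet s).ConnectedComponent

/-- `G` is a member of `C_{n,m}`: a connected simple graph on `n` vertices and `m` edges. -/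
def IsCnm (n m : ℕ) (G : SimpleGraph (Fin n)) : Prop :=
  G.Connected ∧ G.edgeSet.ncard = m

/-- `N_i^{(k)}(G)`: the number of spanning subgraphs of `G` (identified with subsets of
`E(G)`) having exactly `i` edges and at most `k` connected components. -/
noncomputable def Ncnt (n : ℕ) (G : SimpleGraph (Fin n)) (i k : ℕ) : ℕ :=
  Set.ncard {s : Set (Sym2 (Fin n)) | s ⊆ G.edgeSet ∧ s.ncard = i ∧ ncomp n s ≤ k}

/-- `N_{i,j}(G)`: the number of spanning subgraphs of `G` having exactly `i` edges and
exactly `j` connected components. -/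
noncomputable def Nexact (n : ℕ) (G : SimpleGraph (Fin n)) (i j : ℕ) : ℕ :=
  Set.ncard {s : Set (Sym2 (Fin n)) | s ⊆ G.edgeSet ∧ s.ncard = i ∧ ncomp n s = j}

/-- The `k`-reliability of `G` at `p`: `R_G^{(k)}(p) = Σ_{i=0}^m N_i^{(k)}(G) p^i (1-p)^{m-i}`. -/
noncomputable def rel (n m : ℕ) (G : SimpleGraph (Fin n)) (k : ℕ) (p : ℝ) : ℝ :=
  ∑ i ∈ Finset.range (m + 1), (Ncnt n G i k : ℝ) * p ^ i * (1 - p) ^ (m - i)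

/-- The Tutte polynomial of `G`, `T_G(x,y) = Σ_{H ∈ S(G)} (x-1)^{r(G)-r(H)} (y-1)^{c(H)}`,
where the rank of the spanning subgraph with edge set `s` is `n - ncomp n s`, so that
`r(G) - r(H) = ncomp n s - ncomp n G.edgeSet`, and the corank is `s.ncard + ncomp n s - n`. -/
noncomputable def tutte (n : ℕ) (G : SimpleGraph (Fin n)) : MvPolynomial (Fin 2) ℝ :=
  ∑ᶠ s ∈ {t : Set (Sym2 (Fin n)) | t ⊆ G.edgeSet},
    (X 0 - 1) ^ (ncomp n s - ncomp n G.edgeSet) * (X 1 - 1) ^ (s.ncard + ncomp n s - n)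

/-- The Whitney polynomial of `G`, `W_G(x,y) = Σ_{H ∈ S(G)} x^{r(G)-r(H)} y^{c(H)}`. -/
noncomputable def whitney (n : ℕ) (G : SimpleGraph (Fin n)) : MvPolynomial (Fin 2) ℝ :=
  ∑ᶠ s ∈ {t : Set (Sym2 (Fin n)) | t ⊆ G.edgeSet},
    X 0 ^ (ncomp n s - ncomp n G.edgeSet) * X 1 ^ (s.ncard + ncomp n s - n)

/-- A bivariate polynomial is nonnegative if all its coefficients are nonnegative. -/
def NonnegPoly (P : MvPolynomial (Fin 2) ℝ) : Prop :=
  ∀ d : Fin 2 →₀ ℕ, 0 ≤ P.coeff d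

/-- `G` is Tutte-maximum in `C_{n,m}`. -/
def TutteMaximum (n m : ℕ) (G : SimpleGraph (Fin n)) : Prop :=
  ∀ H : SimpleGraph (Fin n), IsCnm n m H →
    ∃ P : MvPolynomial (Fin 2) ℝ, NonnegPoly P ∧
      tutte n G - tutte n H = (X 0 + X 1 - X 0 * X 1) * P

/-- `G` is Whitney-maximum in `C_{n,m}`. -/
def WhitneyMaximum (n m : ℕ) (G : SimpleGraph (Fin n)) : Prop :=
  ∀ H : SimpleGraph (Fin n), IsCnm n m H →
    ∃ Q : MvPolynomial (Fin 2) ℝ, NonnegPoly Q ∧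
      whitney n G - whitney n H = (1 - X 0 * X 1) * Q

/-- `G` is strong in `C_{n,m}`. -/
def Strong (n m : ℕ) (G : SimpleGraph (Fin n)) : Prop :=
  ∀ H : SimpleGraph (Fin n), IsCnm n m H →
    ∀ i ≤ m, ∀ k, 1 ≤ k → k ≤ n → Ncnt n H i k ≤ Ncnt n G i k

/-- `G` is a 0-element in `C_{n,m}`. -/
def ZeroElement (n m : ℕ) (G : SimpleGraph (Fin n)) : Prop :=
  ∀ H : SimpleGraph (Fin n), IsCnm n m H → ∀ i ≤ m, Ncnt n H i 1 ≤ Ncnt n G i 1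

/-- `t_k(G)`: the number of spanning forests of `G` composed of exactly `k` trees. -/
noncomputable def tcount (n : ℕ) (G : SimpleGraph (Fin n)) (k : ℕ) : ℕ :=
  Set.ncard {s : Set (Sym2 (Fin n)) |
    s ⊆ G.edgeSet ∧ (SimpleGraph.fromEdgeSet s).IsAcyclic ∧ ncomp n s = k}

/-- `λ^{(k)}(G)`: the minimum number of edges that must be removed from `G` to obtain a
spanning subgraph with more than `k` connected components. -/
noncomputable def lamk (n : ℕ) (G : SimpleGraph (Fin n)) (k : ℕ) : ℕ :=
  sInf {d : ℕ | ∃ D : Set (Sym2 (Fin n)),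
    D ⊆ G.edgeSet ∧ D.ncard = d ∧ k < ncomp n (G.edgeSet \ D)}

/-- `∂^{a+b} P / ∂x^a ∂y^b` evaluated at `(0,0)`. -/
noncomputable def pdevalXY (P : MvPolynomial (Fin 2) ℝ) (a b : ℕ) : ℝ :=
  MvPolynomial.eval (fun _ => (0 : ℝ))
    ((fun q => MvPolynomial.pderiv (0 : Fin 2) q)^[a]
      ((fun q => MvPolynomial.pderiv (1 : Fin 2) q)^[b] P))

namespace SimpleGraph

variable {V : Type*} {G : SimpleGraph V}

/-- Two vertices joined by a walk in `G` are joined by a walk avoiding the edge `uv`, or each of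
them is joined to an endpoint of `uv` by such a walk. -/
lemma Reachable.deleteEdges_singleton_or {u v x y : V} (h : G.Reachable x y) :
    (G.deleteEdges {s(u, v)}).Reachable x y ∨
      ((G.deleteEdges {s(u, v)}).Reachable x u ∧ (G.deleteEdges {s(u, v)}).Reachable v y) ∨
      ((G.deleteEdges {s(u, v)}).Reachable x v ∧ (G.deleteEdges {s(u, v)}).Reachable u y) := by
  obtain ⟨p⟩ := h
  induction p with
  | nil => exact .inl .rfl
  | @cons a b c hab p ih =>
    by_cases he : s(a, b) = s(u, v)
    · rcases Sym2.eq_iff.mp he with ⟨rfl, rfl⟩ | ⟨rfl, rfl⟩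
      · rcases ih with h | ⟨_, h⟩ | ⟨_, h⟩
        · exact .inr (.inl ⟨.rfl, h⟩)
        · exact .inr (.inl ⟨.rfl, h⟩)
        · exact .inl h
      · rcases ih with h | ⟨_, h⟩ | ⟨_, h⟩
        · exact .inr (.inr ⟨.rfl, h⟩)
        · exact .inl h
        · exact .inr (.inr ⟨.rfl, h⟩)
    · have hab' : (G.deleteEdges {s(u, v)}).Reachable a b :=
        Adj.reachable (by rw [deleteEdges_adj]; exact ⟨hab, he⟩)
      exact ih.imp hab'.trans (Or.imp (And.imp_left hab'.trans) (And.imp_left hab'.trans))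

/-- Deleting a bridge increases the number of connected components by one. -/
lemma IsBridge.card_connectedComponent_deleteEdges [Finite V] {u v : V} (hadj : G.Adj u v)
    (hb : G.IsBridge s(u, v)) :
    Nat.card (G.deleteEdges {s(u, v)}).ConnectedComponent =
      Nat.card G.ConnectedComponent + 1 := by
  classical
  set G' := G.deleteEdges {s(u, v)} with hG'
  have hle : G' ≤ G := deleteEdges_le _
  rw [isBridge_iff, ← hG'] at hb
  let f : {c : G'.ConnectedComponent // c ≠ G'.connectedComponentMk v} → G.ConnectedComponent :=
    fun c ↦ c.1.map (.ofLE hle)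
  have hf : Function.Bijective f := by
    constructor
    · rintro ⟨c, hc⟩ ⟨d, hd⟩ hcd
      induction c using ConnectedComponent.ind with | h x
      induction d using ConnectedComponent.ind with | h y
      have hxy : G.Reachable x y := ConnectedComponent.exact hcd
      rw [Ne, ConnectedComponent.eq] at hc hd
      refine Subtype.ext (ConnectedComponent.sound ?_)
      rcases hxy.deleteEdges_singleton_or (u := u) (v := v) with h | ⟨_, h⟩ | ⟨h, _⟩
      · exact h
      · exact absurd h.symm hd
      · exact absurd h hc
    · intro c
      induction c using ConnectedComponent.ind with | h x
      by_cases hx : G'.Reachable x v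
      · exact ⟨⟨G'.connectedComponentMk u, fun h ↦ hb (ConnectedComponent.exact h)⟩,
          ConnectedComponent.sound (hadj.reachable.trans (hx.mono hle).symm)⟩
      · exact ⟨⟨G'.connectedComponentMk x, fun h ↦ hx (ConnectedComponent.exact h)⟩, rfl⟩
  rw [← Nat.card_eq_of_bijective f hf,
    ← Nat.card_congr (Equiv.optionSubtypeNe (G'.connectedComponentMk v)), Finite.card_option]

/-- The numbers of edges and of components of a forest add up to its number of vertices. -/
lemma IsAcyclic.ncard_edgeSet_add_card_connectedComponent [Finite V] (hG : G.IsAcyclic) :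
    G.edgeSet.ncard + Nat.card G.ConnectedComponent = Nat.card V := by
  induction hk : G.edgeSet.ncard generalizing G with
  | zero =>
    rw [Set.ncard_eq_zero, edgeSet_eq_empty] at hk
    subst hk
    rw [zero_add]
    refine (Nat.card_eq_of_bijective (⊥ : SimpleGraph V).connectedComponentMk
      ⟨fun x y h ↦ ?_, Quot.mk_surjective⟩).symm
    exact reachable_bot.mp (ConnectedComponent.exact h)
  | succ k ih =>
    obtain ⟨e, he⟩ : G.edgeSet.Nonempty := (Set.ncard_pos).mp (by omega)
    have hb := isAcyclic_iff_forall_isBridge.mp hG he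
    induction e using Sym2.ind with | h u v
    have hcard : (G.deleteEdges {s(u, v)}).edgeSet.ncard = k := by
      rw [edgeSet_deleteEdges, Set.ncard_sdiff_singleton_of_mem he, hk, Nat.add_sub_cancel]
    have := ih (hG.anti (deleteEdges_le _)) hcard
    rw [IsBridge.card_connectedComponent_deleteEdges he hb] at this
    omega

/-- A finite graph is a forest if and only if its corank vanishes. -/
lemma isAcyclic_iff_ncard_edgeSet_add_card_connectedComponent_le [Finite V] :
    G.IsAcyclic ↔ G.edgeSet.ncard + Nat.card G.ConnectedComponent ≤ Nat.card V := by
  refine ⟨fun h ↦ h.ncard_edgeSet_add_card_connectedComponent.le, fun h ↦ ?_⟩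
  obtain ⟨F, hle, hF, hr⟩ := G.exists_isAcyclic_reachable_eq_le
  have hc : Nat.card F.ConnectedComponent = Nat.card G.ConnectedComponent := by
    rw [ConnectedComponent, ConnectedComponent, hr]
  have hF' := hF.ncard_edgeSet_add_card_connectedComponent
  have := Set.eq_of_subset_of_ncard_le (edgeSet_mono hle) (by omega)
  rwa [← edgeSet_inj.mp this]

end SimpleGraph

lemma ncomp_pos {n : ℕ} (hn : 0 < n) (s : Set (Sym2 (Fin n))) : 0 < ncomp n s := by
  have : Nonempty (SimpleGraph.fromEdgeSet s).ConnectedComponent :=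
    ⟨SimpleGraph.connectedComponentMk _ ⟨0, hn⟩⟩
  exact Nat.card_pos

lemma ncomp_edgeSet_of_connected {n : ℕ} {G : SimpleGraph (Fin n)} (hG : G.Connected) :
    ncomp n G.edgeSet = 1 := by
  have := hG.nonempty
  rw [ncomp, SimpleGraph.fromEdgeSet_edgeSet, Nat.card_eq_one_iff_unique]
  exact ⟨hG.preconnected.subsingleton_connectedComponent, inferInstance⟩

lemma isAcyclic_fromEdgeSet_iff {n : ℕ} {G : SimpleGraph (Fin n)} {s : Set (Sym2 (Fin n))}
    (hs : s ⊆ G.edgeSet) :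
    (SimpleGraph.fromEdgeSet s).IsAcyclic ↔ s.ncard + ncomp n s - n = 0 := by
  have hd : (SimpleGraph.fromEdgeSet s).edgeSet = s := by
    rw [SimpleGraph.edgeSet_fromEdgeSet]
    exact sdiff_eq_left.mpr (Set.disjoint_left.mpr fun e he hde ↦
      G.not_isDiag_of_mem_edgeSet (hs he) hde)
  rw [SimpleGraph.isAcyclic_iff_ncard_edgeSet_add_card_connectedComponent_le, hd,
    Nat.card_fin, Nat.sub_eq_zero_iff_le, ncomp]

lemma coeff_X_zero_pow_mul_X_one_pow (a b j : ℕ) :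
    coeff (Finsupp.single 0 j) (X 0 ^ a * X 1 ^ b : MvPolynomial (Fin 2) ℝ) =
      if a = j ∧ b = 0 then 1 else 0 := by
  rw [X_pow_eq_monomial, X_pow_eq_monomial, monomial_mul, coeff_monomial, one_mul]
  refine if_congr ?_ rfl rfl
  simp [Finsupp.ext_iff, Fin.forall_fin_two]

/-- The coefficient of `x^{k-1}` in the Whitney polynomial of a connected graph counts the
spanning forests composed of `k` trees. -/
lemma coeff_whitney {n k : ℕ} (hn : 0 < n) (hk : 1 ≤ k) {G : SimpleGraph (Fin n)}
    (hG : G.Connected) :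
    coeff (Finsupp.single 0 (k - 1)) (whitney n G) = (tcount n G k : ℝ) := by
  classical
  have hfin : {t : Set (Sym2 (Fin n)) | t ⊆ G.edgeSet}.Finite := Set.toFinite _
  rw [whitney, finsum_mem_eq_finite_toFinset_sum _ hfin, coeff_sum]
  simp_rw [coeff_X_zero_pow_mul_X_one_pow, ncomp_edgeSet_of_connected hG]
  rw [Finset.sum_boole, tcount, ← Set.ncard_coe_finset]
  congr 2
  ext s
  simp only [Finset.coe_filter, Set.Finite.mem_toFinset, Set.mem_ofPred_eq]
  refine and_congr_right fun hs ↦ ?_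
  rw [isAcyclic_fromEdgeSet_iff hs, and_comm]
  have := ncomp_pos hn s
  exact and_congr_right fun _ ↦ by omega

lemma coeff_one_sub_X_zero_mul_X_one_mul (Q : MvPolynomial (Fin 2) ℝ) (j : ℕ) :
    coeff (Finsupp.single 0 j) ((1 - X 0 * X 1) * Q) = coeff (Finsupp.single 0 j) Q := by
  have h : (1 - X 0 * X 1) * Q = Q - (Q * X 0) * X 1 := by ring
  rw [h, coeff_sub, coeff_mul_X', if_neg (by simp), sub_zero]

/-- each Whitney-maximum graph in `C_{n,m}` has the maximum number of
spanning forests composed of exactly `k` trees, for every `k ∈ {1,…,n}`. -/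
theorem stmt18 (n m : ℕ) (hn : 0 < n) (hm : 0 < m) (G : SimpleGraph (Fin n))
    (hG : IsCnm n m G) (hW : WhitneyMaximum n m G) :
    ∀ k, 1 ≤ k → k ≤ n → ∀ H : SimpleGraph (Fin n), IsCnm n m H →
      tcount n H k ≤ tcount n G k := by
  intro k hk _ H hH
  obtain ⟨Q, hQ, hWQ⟩ := hW H hH
  have hcoeff := congrArg (coeff (Finsupp.single 0 (k - 1))) hWQ
  rw [coeff_sub, coeff_whitney hn hk hG.1, coeff_whitney hn hk hH.1,
    coeff_one_sub_X_zero_mul_X_one_mul] at hcoeff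
  exact_mod_cast sub_nonneg.mp (hcoeff ▸ hQ _)
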